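/- arXiv:2510.03806 — 2 statements merged into one kernel-verified Lean document; each statement's English description precedes it below -/
import Mathlib

section
/- (Equivariance of the off-diagonal component.) Suppose Φ : T_σ(A,B;X) → T_τ(A,B;X) is a multiplicative map of the block form Φ(a,0,0) = (α(a), θ₁(a), 0), Φ(0,x,0) = (0, u(x), 0), Φ(0,0,b) = (0, θ₂(b), β(b)), where α : A → A and β : B → B are maps, u : X → X is a map, and θ₁ : A → X, θ₂ : B → X are maps. Then u intertwines the twisted actions: u(σ_A(a)·x) = τ_A(α(a))·u(x) and u(x·σ_B(b)) = u(x)·τ_B(β(b)) for all a ∈ A, x ∈ X, b ∈ B. -/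
/-- The twisted triangular multiplication on `A × X × B`. -/
def tmul {A B X : Type*} [Mul A] [Mul B] [Add X]
    (σA : A → A) (σB : B → B) (L : A → X → X) (R : X → B → X)
    (u v : A × X × B) : A × X × B :=
  (u.1 * v.1, L (σA u.1) v.2.1 + R u.2.1 (σB v.2.2), u.2.2 * v.2.2)

/-- Equivariance of the off-diagonal component of a block-triangular
multiplicative map: `u(σ_A(a)·x) = τ_A(α(a))·u(x)` and
`u(x·σ_B(b)) = u(x)·τ_B(β(b))`. -/
theorem offdiagonal_equivariance {𝕜 A B X : Type*} [RCLike 𝕜]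
    [NonUnitalNormedRing A] [NormedSpace 𝕜 A] [IsScalarTower 𝕜 A A] [SMulCommClass 𝕜 A A]
    [CompleteSpace A]
    [NonUnitalNormedRing B] [NormedSpace 𝕜 B] [IsScalarTower 𝕜 B B] [SMulCommClass 𝕜 B B]
    [CompleteSpace B]
    [NormedAddCommGroup X] [NormedSpace 𝕜 X] [CompleteSpace X]
    (L : A → X → X) (R : X → B → X)
    (hL_add₁ : ∀ (a a' : A) (x : X), L (a + a') x = L a x + L a' x)
    (hL_add₂ : ∀ (a : A) (x y : X), L a (x + y) = L a x + L a y)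
    (hL_mul : ∀ (a a' : A) (x : X), L (a * a') x = L a (L a' x))
    (hL_smul₁ : ∀ (c : 𝕜) (a : A) (x : X), L (c • a) x = c • L a x)
    (hL_smul₂ : ∀ (c : 𝕜) (a : A) (x : X), L a (c • x) = c • L a x)
    (hL_bdd : ∃ M : ℝ, ∀ (a : A) (x : X), ‖L a x‖ ≤ M * ‖a‖ * ‖x‖)
    (hR_add₁ : ∀ (x y : X) (b : B), R (x + y) b = R x b + R y b)
    (hR_add₂ : ∀ (x : X) (b b' : B), R x (b + b') = R x b + R x b')
    (hR_mul : ∀ (x : X) (b b' : B), R x (b * b') = R (R x b) b')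
    (hR_smul₁ : ∀ (c : 𝕜) (x : X) (b : B), R (c • x) b = c • R x b)
    (hR_smul₂ : ∀ (c : 𝕜) (x : X) (b : B), R x (c • b) = c • R x b)
    (hR_bdd : ∃ M : ℝ, ∀ (x : X) (b : B), ‖R x b‖ ≤ M * ‖x‖ * ‖b‖)
    (h_compat : ∀ (a : A) (x : X) (b : B), R (L a x) b = L a (R x b))
    (σA : A → A) (hσA_bij : Function.Bijective σA)
    (hσA_add : ∀ p q : A, σA (p + q) = σA p + σA q)
    (hσA_mul : ∀ p q : A, σA (p * q) = σA p * σA q)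
    (hσA_smul : ∀ (c : 𝕜) (p : A), σA (c • p) = c • σA p)
    (hσA_cont : Continuous σA)
    (σB : B → B) (hσB_bij : Function.Bijective σB)
    (hσB_add : ∀ p q : B, σB (p + q) = σB p + σB q)
    (hσB_mul : ∀ p q : B, σB (p * q) = σB p * σB q)
    (hσB_smul : ∀ (c : 𝕜) (p : B), σB (c • p) = c • σB p)
    (hσB_cont : Continuous σB)
    (τA : A → A) (hτA_bij : Function.Bijective τA)
    (hτA_add : ∀ p q : A, τA (p + q) = τA p + τA q)
    (hτA_mul : ∀ p q : A, τA (p * q) = τA p * τA q)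
    (hτA_smul : ∀ (c : 𝕜) (p : A), τA (c • p) = c • τA p)
    (hτA_cont : Continuous τA)
    (τB : B → B) (hτB_bij : Function.Bijective τB)
    (hτB_add : ∀ p q : B, τB (p + q) = τB p + τB q)
    (hτB_mul : ∀ p q : B, τB (p * q) = τB p * τB q)
    (hτB_smul : ∀ (c : 𝕜) (p : B), τB (c • p) = c • τB p)
    (hτB_cont : Continuous τB)
    (Φ : A × X × B → A × X × B)
    (α : A → A) (β : B → B) (u : X → X) (θ₁ : A → X) (θ₂ : B → X)
    (hΦ_mul : ∀ p q : A × X × B,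
      Φ (tmul σA σB L R p q) = tmul τA τB L R (Φ p) (Φ q))
    (hΦ_diagA : ∀ a : A, Φ (a, (0 : X), (0 : B)) = (α a, θ₁ a, (0 : B)))
    (hΦ_off : ∀ x : X, Φ ((0 : A), x, (0 : B)) = ((0 : A), u x, (0 : B)))
    (hΦ_diagB : ∀ b : B, Φ ((0 : A), (0 : X), b) = ((0 : A), θ₂ b, β b)) :
    (∀ (a : A) (x : X), u (L (σA a) x) = L (τA (α a)) (u x)) ∧
    (∀ (x : X) (b : B), u (R x (σB b)) = R (u x) (τB (β b))) := by
  have hσA : σA 0 = 0 := map_zero (AddMonoidHom.mk' σA hσA_add)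
  have hσB : σB 0 = 0 := map_zero (AddMonoidHom.mk' σB hσB_add)
  have hτA : τA 0 = 0 := map_zero (AddMonoidHom.mk' τA hτA_add)
  have hτB : τB 0 = 0 := map_zero (AddMonoidHom.mk' τB hτB_add)
  have hL (x : X) : L 0 x = 0 := map_zero (AddMonoidHom.mk' (L · x) fun a a' => hL_add₁ a a' x)
  have hR (x : X) : R x 0 = 0 := map_zero (AddMonoidHom.mk' (R x) (hR_add₂ x))
  constructor
  · intro a x
    have h := hΦ_mul (a, 0, 0) (0, x, 0)
    simpa [tmul, hΦ_diagA, hΦ_off, hσB, hτB, hR] using h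
  · intro x b
    have h := hΦ_mul (0, x, 0) (0, 0, b)
    simpa [tmul, hΦ_diagB, hΦ_off, hσA, hτA, hL] using h
end

section
/- (Symmetry and scalar structure of cocycle components.) Let 𝕂 be ℝ or ℂ and let X be a 𝕂-vector space. If θ : 𝕂 × 𝕂 → X satisfies θ(a a', b b') = a • θ(a',b') + b' • θ(a,b) for all a, a', b, b' ∈ 𝕂, then: (i) θ(a,b) = θ(a,1) + θ(1,b) for all a, b; (ii) θ(1,1) = 0; (iii) the map f(a) := θ(a,1) satisfies f(a) = (1 − a) • f(0) for all a; and (iv) the map g(b) := θ(1,b) satisfies g(b) = (1 − b) • g(0) for all b. -/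
/-- Structure of scalar cocycle components: `θ(a,b) = θ(a,1) + θ(1,b)`,
`θ(1,1) = 0`, `θ(a,1) = (1 − a) • θ(0,1)` and `θ(1,b) = (1 − b) • θ(1,0)`. -/
theorem scalar_cocycle_components {𝕜 X : Type*} [RCLike 𝕜]
    [AddCommGroup X] [Module 𝕜 X]
    (θ : 𝕜 × 𝕜 → X)
    (hθ : ∀ a a' b b' : 𝕜,
      θ (a * a', b * b') = a • θ (a', b') + b' • θ (a, b)) :
    (∀ a b : 𝕜, θ (a, b) = θ (a, 1) + θ (1, b)) ∧
    θ (1, 1) = 0 ∧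
    (∀ a : 𝕜, θ (a, 1) = (1 - a) • θ (0, 1)) ∧
    (∀ b : 𝕜, θ (1, b) = (1 - b) • θ (1, 0)) := by
  refine ⟨fun a b => ?_, ?_, fun a => ?_, fun b => ?_⟩
  · simpa [add_comm] using hθ 1 a b 1
  · simpa using hθ 1 1 1 1
  · have h := hθ a 0 1 1
    simp only [mul_zero, mul_one, one_smul] at h
    rw [sub_smul, one_smul, eq_sub_iff_add_eq, add_comm]
    exact h.symm
  · have h := hθ 1 1 0 b
    simp only [zero_mul, mul_one, one_smul] at h
    rw [sub_smul, one_smul, eq_sub_iff_add_eq]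
    exact h.symm
end
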